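/- Let (X,d,μ) be a metric measure space with μ Borel, and let Γ be a family of rectifiable curves in X with essℓ(Γ) ∈ (0,∞). Then Mod_∞(Γ) = 1/essℓ(Γ) ∈ (0,∞), and the constant density ρ₀ ≡ 1/essℓ(Γ) is an extremal weakly admissible density (i.e., ρ₀ is weakly admissible for Γ and ‖ρ₀‖_∞ = Mod_∞(Γ)). -/

import Mathlib

open MeasureTheory
open scoped ENNReal

/-- A *curve* in a metric space `X`: a nonconstant continuous map from a compact
interval `[a,b] ⊆ ℝ` into `X`. -/
structure Curve (X : Type*) [MetricSpace X] where
  a : ℝ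
  b : ℝ
  hab : a ≤ b
  toFun : ℝ → X
  cont : ContinuousOn toFun (Set.Icc a b)
  nonconst : ∃ s ∈ Set.Icc a b, ∃ t ∈ Set.Icc a b, toFun s ≠ toFun t

namespace Curve

variable {X : Type*} [MetricSpace X]

/-- The length of a curve: the total variation of `γ` on `[a,b]`. -/
noncomputable def length (γ : Curve X) : ℝ≥0∞ :=
  eVariationOn γ.toFun (Set.Icc γ.a γ.b)

/-- A curve is rectifiable if it has finite length. -/
def Rectifiable (γ : Curve X) : Prop := γ.length ≠ ∞

/-- The length function `s_γ(t) = length (γ|_[a,t])`. -/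
noncomputable def lenFun (γ : Curve X) (t : ℝ) : ℝ :=
  (eVariationOn γ.toFun (Set.Icc γ.a t)).toReal

/-- The right inverse `s_γ⁻¹(t) = max {s ∈ [a,b] : s_γ(s) = t}` of the length function. -/
noncomputable def lenInv (γ : Curve X) (t : ℝ) : ℝ :=
  sSup {s | s ∈ Set.Icc γ.a γ.b ∧ γ.lenFun s = t}

/-- The arc-length parametrization `γ_s(t) = γ(s_γ⁻¹(t))`. -/
noncomputable def param (γ : Curve X) (t : ℝ) : X := γ.toFun (γ.lenInv t)

/-- The parameter domain `[0, length γ]` of the arc-length parametrization,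
as a subset of `ℝ` (it is all of `[0,∞)` when `γ` has infinite length). -/
def paramDomain (γ : Curve X) : Set ℝ := {t : ℝ | 0 ≤ t ∧ ENNReal.ofReal t ≤ γ.length}

/-- The line integral `∫_γ ρ ds = ∫_0^{length γ} ρ(γ_s(t)) dt` of a density `ρ` along `γ`. -/
noncomputable def lineIntegral (γ : Curve X) (ρ : X → ℝ≥0∞) : ℝ≥0∞ :=
  ∫⁻ t in γ.paramDomain, ρ (γ.param t)

/-- `σ` is a subcurve of `γ` if it is the restriction of `γ` to a subinterval. -/
def IsSubcurve (σ γ : Curve X) : Prop :=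
  γ.a ≤ σ.a ∧ σ.b ≤ γ.b ∧ ∀ t ∈ Set.Icc σ.a σ.b, σ.toFun t = γ.toFun t

/-- A curve is locally rectifiable if every interior point of its parameter interval has a
neighbourhood on which the curve is rectifiable. -/
def LocallyRectifiable (γ : Curve X) : Prop :=
  ∀ t ∈ Set.Ioo γ.a γ.b, ∃ u v : ℝ, u < t ∧ t < v ∧
    eVariationOn γ.toFun (Set.Icc (max γ.a u) (min γ.b v)) ≠ ∞

/-- A curve has positive length in a set `F`: `m₁(γ_s⁻¹(F)) > 0`. -/
def PosLength (γ : Curve X) (F : Set X) : Prop :=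
  0 < volume (γ.paramDomain ∩ γ.param ⁻¹' F)

end Curve

section Modulus

variable {X : Type*} [MetricSpace X] [MeasurableSpace X] [BorelSpace X]

/-- A density (nonnegative Borel function) `ρ` is admissible for a curve family `Γ`
if `∫_γ ρ ds ≥ 1` for every `γ ∈ Γ`. -/
def Admissible (Γ : Set (Curve X)) (ρ : X → ℝ≥0∞) : Prop :=
  Measurable ρ ∧ ∀ γ ∈ Γ, 1 ≤ γ.lineIntegral ρ

/-- The supremum-modulus `Mod_sup(Γ) = inf {sup_X ρ : ρ ∈ Adm(Γ)}`. -/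
noncomputable def ModSup (Γ : Set (Curve X)) : ℝ≥0∞ :=
  ⨅ ρ ∈ {ρ : X → ℝ≥0∞ | Admissible Γ ρ}, ⨆ x, ρ x

/-- `Mod_∞^*(Γ) = inf {‖ρ‖_∞ : ρ ∈ Adm(Γ)}`. -/
noncomputable def ModInfty (μ : Measure X) (Γ : Set (Curve X)) : ℝ≥0∞ :=
  ⨅ ρ ∈ {ρ : X → ℝ≥0∞ | Admissible Γ ρ}, essSup ρ μ

/-- A curve family is `∞`-exceptional if `Mod_∞^*(Γ) = 0`. -/
def Exceptional (μ : Measure X) (Γ : Set (Curve X)) : Prop :=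
  ModInfty μ Γ = 0

/-- `ρ` is weakly admissible for `Γ` if `∫_γ ρ ds ≥ 1` for `∞`-a.e. curve `γ ∈ Γ`. -/
def WeaklyAdmissible (μ : Measure X) (Γ : Set (Curve X)) (ρ : X → ℝ≥0∞) : Prop :=
  Measurable ρ ∧ Exceptional μ {γ ∈ Γ | γ.lineIntegral ρ < 1}

/-- The `∞`-modulus `Mod_∞(Γ) = inf {‖ρ‖_∞ : ρ weakly admissible for Γ}`. -/
noncomputable def ModInftyW (μ : Measure X) (Γ : Set (Curve X)) : ℝ≥0∞ :=
  ⨅ ρ ∈ {ρ : X → ℝ≥0∞ | WeaklyAdmissible μ Γ ρ}, essSup ρ μ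

/-- The essential length `essℓ(Γ) = sup {a ≥ 0 : Γ(a) = {γ ∈ Γ : length γ < a} is ∞-exceptional}`. -/
noncomputable def essLen (μ : Measure X) (Γ : Set (Curve X)) : ℝ≥0∞ :=
  sSup {a : ℝ≥0∞ | Exceptional μ {γ ∈ Γ | γ.length < a}}

/-- The family `Γ(x,y)` of rectifiable curves connecting `x` to `y`. -/
def ConnCurves (x y : X) : Set (Curve X) :=
  {γ : Curve X | γ.Rectifiable ∧ γ.toFun γ.a = x ∧ γ.toFun γ.b = y}

open scoped Classical in
/-- The essential metric `d_ess(x,y) = essℓ(Γ(x,y))` for `x ≠ y`, and `0` on the diagonal. -/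
noncomputable def dEss (μ : Measure X) (x y : X) : ℝ≥0∞ :=
  if x = y then 0 else essLen μ (ConnCurves x y)

end Modulus

namespace Curve

variable {X : Type*} [MetricSpace X]

theorem volume_paramDomain {γ : Curve X} (h : γ.Rectifiable) :
    volume γ.paramDomain = γ.length := by
  have hset : γ.paramDomain = Set.Icc 0 γ.length.toReal := by
    ext t
    simp only [paramDomain, Set.mem_ofPred_eq, Set.mem_Icc]
    rw [ENNReal.ofReal_le_iff_le_toReal h]
  rw [hset, Real.volume_Icc, sub_zero, ENNReal.ofReal_toReal h]

theorem lineIntegral_const {γ : Curve X} (h : γ.Rectifiable) (c : ℝ≥0∞) :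
    γ.lineIntegral (fun _ => c) = c * γ.length := by
  rw [lineIntegral, setLIntegral_const, volume_paramDomain h]

theorem lineIntegral_mono (γ : Curve X) {ρ σ : X → ℝ≥0∞} (h : ρ ≤ σ) :
    γ.lineIntegral ρ ≤ γ.lineIntegral σ :=
  lintegral_mono fun t => h (γ.param t)

/-- The line integral of the density `∞ · 1_N` is either `0` or `∞`. -/
theorem lineIntegral_indicator_top (γ : Curve X) {N : Set X}
    (h : γ.lineIntegral (N.indicator fun _ => ∞) ≠ 0) :
    γ.lineIntegral (N.indicator fun _ => ∞) = ∞ := by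
  have hle : ∞ * γ.lineIntegral (N.indicator fun _ => ∞) ≤
      γ.lineIntegral (N.indicator fun _ => ∞) := by
    refine (lintegral_const_mul_le _ _).trans (lintegral_mono fun t => ?_)
    by_cases ht : γ.param t ∈ N <;> simp [ht]
  rwa [ENNReal.top_mul h, top_le_iff] at hle

/-- A curve of length less than `c⁻¹` along which `ρ` integrates to at least `1` has infinite
`∞ · 1_{ρ ≥ c}`-length. -/
theorem lineIntegral_indicator_superlevel {γ : Curve X} {ρ : X → ℝ≥0∞} {c : ℝ≥0∞}
    (hc : c ≠ 0) (hlen : γ.length < c⁻¹) (hρ : 1 ≤ γ.lineIntegral ρ) :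
    γ.lineIntegral ({x | c ≤ ρ x}.indicator fun _ => ∞) = ∞ := by
  refine γ.lineIntegral_indicator_top fun hzero => ?_
  have hrect : γ.Rectifiable := hlen.ne_top
  have hsum : γ.lineIntegral ρ ≤ c * γ.length := by
    calc γ.lineIntegral ρ
        ≤ γ.lineIntegral fun x => c + {x | c ≤ ρ x}.indicator (fun _ => ∞) x := by
          refine γ.lineIntegral_mono fun x => ?_
          by_cases hx : c ≤ ρ x
          · simp [hx]
          · simpa [hx] using (not_le.1 hx).le
      _ = γ.lineIntegral (fun _ => c) + γ.lineIntegral ({x | c ≤ ρ x}.indicator fun _ => ∞) :=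
          lintegral_add_left measurable_const _
      _ = c * γ.length := by rw [hzero, add_zero, lineIntegral_const hrect]
  refine (hρ.trans hsum).not_gt ?_
  have hctop : c ≠ ∞ := ENNReal.inv_ne_zero.1 (bot_le.trans_lt hlen).ne'
  rw [← one_div, ENNReal.lt_div_iff_mul_lt (.inl hc) (.inl hctop)] at hlen
  rwa [mul_comm]

end Curve

section Exceptional

variable {X : Type*} [MetricSpace X] [MeasurableSpace X] {μ : Measure X}

theorem Exceptional.exists_essSup_lt {Γ : Set (Curve X)} (h : Exceptional μ Γ) {ε : ℝ≥0∞}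
    (hε : 0 < ε) : ∃ ρ, Admissible Γ ρ ∧ essSup ρ μ < ε := by
  have h' : ModInfty μ Γ < ε := by rwa [show ModInfty μ Γ = 0 from h]
  obtain ⟨ρ, hlt⟩ := iInf_lt_iff.1 h'
  obtain ⟨hadm, hlt⟩ := iInf_lt_iff.1 hlt
  exact ⟨ρ, hadm, hlt⟩

theorem exceptional_of_forall_exists {Γ : Set (Curve X)}
    (h : ∀ ε : ℝ≥0∞, 0 < ε → ∃ ρ, Admissible Γ ρ ∧ essSup ρ μ ≤ ε) : Exceptional μ Γ := by
  refine le_antisymm (le_of_forall_gt fun ε hε => ?_) bot_le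
  obtain ⟨δ, hδ, hδε⟩ := exists_between hε
  obtain ⟨ρ, hρ, hle⟩ := h δ hδ
  exact (iInf₂_le_of_le ρ hρ hle).trans_lt hδε

theorem Exceptional.mono {Γ Γ' : Set (Curve X)} (h : Exceptional μ Γ') (hs : Γ ⊆ Γ') :
    Exceptional μ Γ :=
  exceptional_of_forall_exists fun _ hε =>
    let ⟨ρ, hρ, hlt⟩ := h.exists_essSup_lt hε
    ⟨ρ, ⟨hρ.1, fun γ hγ => hρ.2 γ (hs hγ)⟩, hlt.le⟩

theorem exceptional_empty : Exceptional μ (∅ : Set (Curve X)) :=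
  exceptional_of_forall_exists fun _ _ =>
    ⟨0, ⟨measurable_zero, by simp⟩, essSup_le_of_ae_le _ (.of_forall fun _ => zero_le)⟩

theorem exceptional_iUnion {Γ : ℕ → Set (Curve X)} (h : ∀ n, Exceptional μ (Γ n)) :
    Exceptional μ (⋃ n, Γ n) := by
  refine exceptional_of_forall_exists fun ε hε => ?_
  choose ρ hρ hlt using fun n => (h n).exists_essSup_lt hε
  refine ⟨fun x => ⨆ n, ρ n x, ⟨.iSup fun n => (hρ n).1, fun γ hγ => ?_⟩, ?_⟩
  · obtain ⟨n, hn⟩ := Set.mem_iUnion.1 hγ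
    exact ((hρ n).2 γ hn).trans (γ.lineIntegral_mono fun x => le_iSup (fun n => ρ n x) n)
  · refine essSup_le_of_ae_le ε ?_
    filter_upwards [ae_all_iff.2 fun n => ae_lt_of_essSup_lt (hlt n)] with x hx
    exact iSup_le fun n => (hx n).le

theorem exceptional_length_lt_of_lt_essLen {Γ : Set (Curve X)} {a : ℝ≥0∞}
    (ha : a < essLen μ Γ) : Exceptional μ {γ ∈ Γ | γ.length < a} := by
  obtain ⟨b, hb, hab⟩ := lt_sSup_iff.1 ha
  exact Exceptional.mono hb fun γ hγ => ⟨hγ.1, hγ.2.trans hab⟩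

theorem exceptional_length_lt_essLen {Γ : Set (Curve X)} (h0 : 0 < essLen μ Γ) :
    Exceptional μ {γ ∈ Γ | γ.length < essLen μ Γ} := by
  obtain ⟨u, -, hu, hlim⟩ := exists_seq_strictMono_tendsto' h0
  refine (exceptional_iUnion fun n => exceptional_length_lt_of_lt_essLen (hu n).2).mono
    fun γ hγ => ?_
  obtain ⟨n, hn⟩ := (hlim.eventually (lt_mem_nhds hγ.2)).exists
  exact Set.mem_iUnion.2 ⟨n, hγ.1, hn⟩

theorem WeaklyAdmissible.inv_essLen_le_essSup {Γ : Set (Curve X)} {ρ : X → ℝ≥0∞}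
    (hρ : WeaklyAdmissible μ Γ ρ) : (essLen μ Γ)⁻¹ ≤ essSup ρ μ := by
  by_contra! hlt
  obtain ⟨c, hc, hcE⟩ := exists_between hlt
  have hc0 : c ≠ 0 := (bot_le.trans_lt hc).ne'
  refine (ENNReal.lt_inv_iff_lt_inv.1 hcE).not_ge (le_sSup ?_)
  refine exceptional_of_forall_exists fun ε hε => ?_
  obtain ⟨σ, hσ, hσε⟩ := hρ.2.exists_essSup_lt hε
  have hN : MeasurableSet {x | c ≤ ρ x} := measurableSet_le measurable_const hρ.1
  refine ⟨fun x => max ({x | c ≤ ρ x}.indicator (fun _ => ∞) x) (σ x),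
    ⟨(measurable_const.indicator hN).max hσ.1, fun γ hγ => ?_⟩, essSup_le_of_ae_le ε ?_⟩
  · by_cases h1 : γ.lineIntegral ρ < 1
    · exact (hσ.2 γ ⟨hγ.1, h1⟩).trans (γ.lineIntegral_mono fun x => le_max_right _ _)
    · have htop := Curve.lineIntegral_indicator_superlevel hc0 hγ.2 (not_lt.1 h1)
      exact (le_top.trans_eq htop.symm).trans (γ.lineIntegral_mono fun x => le_max_left _ _)
  · filter_upwards [ae_lt_of_essSup_lt hc, ae_lt_of_essSup_lt hσε] with x hx hx'
    simpa [hx.not_ge] using hx'.le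

theorem weaklyAdmissible_inv_essLen {Γ : Set (Curve X)} (hΓ : ∀ γ ∈ Γ, γ.Rectifiable)
    (h0 : 0 < essLen μ Γ) (hfin : essLen μ Γ < ∞) :
    WeaklyAdmissible μ Γ (fun _ => (essLen μ Γ)⁻¹) := by
  refine ⟨measurable_const, (exceptional_length_lt_essLen h0).mono fun γ hγ => ⟨hγ.1, ?_⟩⟩
  have h : (essLen μ Γ)⁻¹ * γ.length < 1 := by
    simpa only [Set.mem_ofPred_eq, Curve.lineIntegral_const (hΓ γ hγ.1)] using hγ.2
  rw [mul_comm, ← ENNReal.lt_div_iff_mul_lt (.inl (ENNReal.inv_ne_zero.2 hfin.ne))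
    (.inl (ENNReal.inv_ne_top.2 h0.ne')), one_div, inv_inv] at h
  exact h

theorem nonempty_of_essLen_ne_top {Γ : Set (Curve X)} (h : essLen μ Γ ≠ ∞) : Γ.Nonempty := by
  rw [Set.nonempty_iff_ne_empty]
  rintro rfl
  exact h (top_le_iff.1 (le_sSup (by simpa using exceptional_empty)))

end Exceptional

/-- If `essℓ(Γ) ∈ (0,∞)`, then `Mod_∞(Γ) = 1/essℓ(Γ) ∈ (0,∞)` and the constant density
`ρ₀ ≡ 1/essℓ(Γ)` is an extremal weakly admissible density. -/
theorem modInftyW_eq_inv_essLen {X : Type*} [MetricSpace X] [TopologicalSpace.SeparableSpace X]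
    [MeasurableSpace X] [BorelSpace X] (μ : Measure X)
    (hμ : ∀ x : X, ∃ r > 0, 0 < μ (Metric.ball x r) ∧ μ (Metric.ball x r) < ∞)
    (Γ : Set (Curve X)) (hΓ : ∀ γ ∈ Γ, γ.Rectifiable)
    (h0 : 0 < essLen μ Γ) (hfin : essLen μ Γ < ∞) :
    ModInftyW μ Γ = (essLen μ Γ)⁻¹ ∧
    0 < ModInftyW μ Γ ∧ ModInftyW μ Γ < ∞ ∧
    WeaklyAdmissible μ Γ (fun _ => (essLen μ Γ)⁻¹) ∧
    essSup (fun _ : X => (essLen μ Γ)⁻¹) μ = ModInftyW μ Γ := by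
  obtain ⟨γ, -⟩ := nonempty_of_essLen_ne_top hfin.ne
  obtain ⟨r, -, hr, -⟩ := hμ (γ.toFun γ.a)
  have hμ0 : μ ≠ 0 := by
    rintro rfl
    simp at hr
  have hadm := weaklyAdmissible_inv_essLen hΓ h0 hfin
  have hess : essSup (fun _ : X => (essLen μ Γ)⁻¹) μ = (essLen μ Γ)⁻¹ := essSup_const _ hμ0
  have hmod : ModInftyW μ Γ = (essLen μ Γ)⁻¹ :=
    le_antisymm (iInf₂_le_of_le _ hadm hess.le)
      (le_iInf₂ fun _ hρ => WeaklyAdmissible.inv_essLen_le_essSup hρ)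
  rw [hmod]
  exact ⟨rfl, ENNReal.inv_pos.2 hfin.ne, ENNReal.inv_lt_top.2 h0, hadm, hess⟩
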